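/- Let M > 0, let r₋₁ ∈ (M, 2M), and set r₋₂ := M + (r₋₁ − M)/2. There exists a constant C > 0, depending only on M and r₋₁, such that for every p ∈ [−1, 1) and every function φ : [M, r₋₁] → ℝ which is continuous on [M, r₋₁] and C¹ on (M, r₋₁], writing ψ(r) := r·φ(r), one has (1 − p)² · ∫_M^{r₋₁} (r − M)^{−p} r² φ(r)² dr ≤ C · ( ∫_M^{r₋₁} (r − M)^{2−p} r^{−2} ψ'(r)² dr + ∫_{r₋₂}^{r₋₁} φ(r)² dr ), where the inequality is understood in [0, ∞]. -/

import Mathlib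

open Real Filter Set MeasureTheory

/-- Hardy inequality on `(c, b]` with a power weight and a boundary term at `b`. -/
theorem lintegral_rpow_hardy {c b k : ℝ} (hcb : c ≤ b) (hk : 0 < k) {ψ : ℝ → ℝ}
    (hψ : ContinuousOn ψ (Icc c b)) (hd : ∀ x ∈ Ioo c b, DifferentiableAt ℝ ψ x) :
    ENNReal.ofReal (k ^ 2) * ∫⁻ x in Ioc c b, ENNReal.ofReal ((x - c) ^ (k - 1) * ψ x ^ 2) ≤
      ENNReal.ofReal (2 * k * (b - c) ^ k * ψ b ^ 2) +
        ENNReal.ofReal 4 *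
          ∫⁻ x in Ioc c b, ENNReal.ofReal ((x - c) ^ (k + 1) * deriv ψ x ^ 2) := by
  set f : ℝ → ℝ := fun x => (x - c) ^ (k - 1) * ψ x ^ 2
  set g : ℝ → ℝ := fun x => (x - c) ^ (k + 1) * deriv ψ x ^ 2
  have hf0 : ∀ x ∈ Ioc c b, 0 ≤ f x := fun x hx =>
    mul_nonneg (rpow_nonneg (sub_nonneg.2 hx.1.le) _) (sq_nonneg _)
  have hg0 : ∀ x ∈ Ioc c b, 0 ≤ g x := fun x hx =>
    mul_nonneg (rpow_nonneg (sub_nonneg.2 hx.1.le) _) (sq_nonneg _)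
  have hgm : Measurable g := by
    have := measurable_deriv ψ
    fun_prop
  by_cases htop : ∫⁻ x in Ioc c b, ENNReal.ofReal (g x) = ⊤
  · rw [htop, ENNReal.mul_top (by simp)]
    simp
  have hgi : IntegrableOn g (Ioc c b) := by
    refine ⟨hgm.aestronglyMeasurable, ?_⟩
    rw [hasFiniteIntegral_iff_ofReal ((ae_restrict_iff' measurableSet_Ioc).2 (ae_of_all _ hg0))]
    exact lt_top_iff_ne_top.2 htop
  have hfi : IntegrableOn f (Icc c b) := by
    refine IntegrableOn.mul_continuousOn ?_ (hψ.pow 2) isCompact_Icc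
    have h := (intervalIntegral.intervalIntegrable_rpow' (a := 0) (b := b - c)
      (show -1 < k - 1 by linarith)).comp_sub_right c
    rw [intervalIntegrable_iff_integrableOn_Icc_of_le (by linarith)] at h
    simpa using h
  have hgi' : IntegrableOn g (Icc c b) := (integrableOn_Icc_iff_integrableOn_Ioc).2 hgi
  have key : ∫ x in c..b, (k / 2 * f x - 2 / k * g x) ≤
      (b - c) ^ k * ψ b ^ 2 - (c - c) ^ k * ψ c ^ 2 := by
    refine intervalIntegral.integral_le_sub_of_hasDeriv_right_of_le
      (g := fun x => (x - c) ^ k * ψ x ^ 2)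
      (g' := fun x => k * (x - c) ^ (k - 1) * ψ x ^ 2 + (x - c) ^ k * (2 * ψ x * deriv ψ x))
      hcb ?_ ?_ ((hfi.const_mul _).sub (hgi'.const_mul _)) ?_
    · refine ContinuousOn.mul ?_ (hψ.pow 2)
      exact (continuousOn_id.sub continuousOn_const).rpow_const fun x _ => Or.inr hk.le
    · intro x hx
      have hx0 : x - c ≠ 0 := (sub_pos.2 hx.1).ne'
      have h1 := ((hasDerivAt_id x).sub_const c).rpow_const (p := k) (Or.inl hx0)
      have h2 := (hd x hx).hasDerivAt.pow 2
      refine (HasDerivAt.congr_deriv (h1.mul h2) ?_).hasDerivWithinAt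
      simp
    · intro x hx
      have hx0 : 0 < x - c := sub_pos.2 hx.1
      have e1 : (x - c) ^ k = (x - c) ^ (k - 1) * (x - c) := by
        rw [← rpow_add_one hx0.ne']; ring_nf
      have e2 : (x - c) ^ (k + 1) = (x - c) ^ (k - 1) * (x - c) ^ 2 := by
        rw [rpow_add_one hx0.ne', e1]; ring
      have hw : 0 ≤ (x - c) ^ (k - 1) := rpow_nonneg hx0.le _
      simp only [f, g, e1, e2]
      have hsq : 0 ≤ (x - c) ^ (k - 1) / (2 * k) *
          (k * ψ x + 2 * ((x - c) * deriv ψ x)) ^ 2 := by positivity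
      have : k * (x - c) ^ (k - 1) * ψ x ^ 2 +
          (x - c) ^ (k - 1) * (x - c) * (2 * ψ x * deriv ψ x) -
          (k / 2 * ((x - c) ^ (k - 1) * ψ x ^ 2) -
            2 / k * ((x - c) ^ (k - 1) * (x - c) ^ 2 * deriv ψ x ^ 2)) =
          (x - c) ^ (k - 1) / (2 * k) * (k * ψ x + 2 * ((x - c) * deriv ψ x)) ^ 2 := by
        field_simp
        ring
      linarith
  rw [sub_self, zero_rpow hk.ne', zero_mul, sub_zero, intervalIntegral.integral_of_le hcb] at key
  have hfi' : IntegrableOn f (Ioc c b) := hfi.mono_set Ioc_subset_Icc_self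
  rw [integral_sub (hfi'.const_mul _) (hgi.const_mul _), integral_const_mul,
    integral_const_mul] at key
  rw [← ofReal_integral_eq_lintegral_ofReal hfi'
      ((ae_restrict_iff' measurableSet_Ioc).2 (ae_of_all _ hf0)),
    ← ofReal_integral_eq_lintegral_ofReal hgi
      ((ae_restrict_iff' measurableSet_Ioc).2 (ae_of_all _ hg0)),
    ← ENNReal.ofReal_mul (by positivity), ← ENNReal.ofReal_mul (by norm_num),
    ← ENNReal.ofReal_add
      (mul_nonneg (mul_nonneg (by positivity) (rpow_nonneg (by linarith) _)) (sq_nonneg _))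
      (mul_nonneg (by norm_num) (setIntegral_nonneg measurableSet_Ioc hg0))]
  apply ENNReal.ofReal_le_ofReal
  have := mul_le_mul_of_nonneg_left key (show 0 ≤ 2 * k by positivity)
  have e : 2 * k * (k / 2 * (∫ x in Ioc c b, f x) - 2 / k * ∫ x in Ioc c b, g x) =
      k ^ 2 * (∫ x in Ioc c b, f x) - 4 * ∫ x in Ioc c b, g x := by
    field_simp
    ring
  linarith

theorem rpow_le_inv_add_sq {x t : ℝ} (hx : 0 < x) (ht : -1 ≤ t) (ht' : t ≤ 2) :
    x ^ t ≤ x⁻¹ + x ^ 2 := by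
  rcases le_total x 1 with h | h
  · have := rpow_le_rpow_of_exponent_ge hx h ht
    rw [rpow_neg_one] at this
    nlinarith [sq_nonneg x]
  · have := rpow_le_rpow_of_exponent_le h ht'
    rw [rpow_two] at this
    have := inv_pos.2 hx
    linarith

/-- Near-horizon `(r-M)^{-p}`-weighted Hardy inequality (one-dimensional form of Lemma 4.1,
first inequality): for `p ∈ [-1, 1)` and `ψ = rφ`,
`(1-p)² ∫_M^{r₋₁} (r-M)^{-p} r² φ² dr ≤ C (∫_M^{r₋₁} (r-M)^{2-p} r^{-2} (ψ')² dr + ∫_{r₋₂}^{r₋₁} φ² dr)`.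
-/
theorem stmt7 (M r₁ : ℝ) (hM : 0 < M) (h1 : M < r₁) (h2 : r₁ < 2 * M) :
    ∃ C : ℝ, 0 < C ∧ ∀ p : ℝ, p ∈ Set.Ico (-1 : ℝ) 1 →
      ∀ φ : ℝ → ℝ, ContinuousOn φ (Set.Icc M r₁) → ContDiffOn ℝ 1 φ (Set.Ioc M r₁) →
        ENNReal.ofReal ((1 - p) ^ 2) *
            ∫⁻ r in Set.Ioc M r₁, ENNReal.ofReal ((r - M) ^ (-p) * r ^ 2 * (φ r) ^ 2) ≤
          ENNReal.ofReal C *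
            ((∫⁻ r in Set.Ioc M r₁,
                ENNReal.ofReal
                  ((r - M) ^ (2 - p) * r ^ (-2 : ℝ) * (deriv (fun ρ => ρ * φ ρ) r) ^ 2)) +
              ∫⁻ r in Set.Ioc (M + (r₁ - M) / 2) r₁, ENNReal.ofReal ((φ r) ^ 2)) := by
  obtain ⟨a, ha⟩ : ∃ a, a = r₁ - M := ⟨_, rfl⟩
  have ha0 : 0 < a := by linarith
  set K : ℝ := (a / 2)⁻¹ + a ^ 2
  have hK : 0 < K := by positivity
  have hKb : ∀ x t : ℝ, a / 2 ≤ x → x ≤ a → -1 ≤ t → t ≤ 2 → x ^ t ≤ K := by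
    intro x t hx hx' ht ht'
    have hx0 : 0 < x := by linarith
    refine (rpow_le_inv_add_sq hx0 ht ht').trans ?_
    simp only [K]
    gcongr
  refine ⟨4 * M ^ 2 * (4 + 4 * K * ((a / 2)⁻¹ + 1)), by positivity, ?_⟩
  rintro p ⟨hp, hp'⟩ φ hφ hφd
  set ψ : ℝ → ℝ := fun ρ => ρ * φ ρ
  set m := M + (r₁ - M) / 2
  have hMm : M < m := by simp only [m]; linarith
  have hm : m < r₁ := by simp only [m]; linarith
  have hψ : ContinuousOn ψ (Icc M r₁) := continuousOn_id.mul hφ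
  have hψd : ∀ x ∈ Ioo M r₁, DifferentiableAt ℝ ψ x := fun x hx =>
    differentiableAt_id.mul (((hφd.differentiableOn (by norm_num)) x
      (Ioo_subset_Ioc_self hx)).differentiableAt (Ioc_mem_nhds hx.1 hx.2))
  obtain ⟨s, hs, hmin⟩ := isCompact_Icc.exists_isMinOn (nonempty_Icc.2 hm.le)
    ((hψ.mono (Icc_subset_Icc_left hMm.le)).pow 2)
  have hMs : M < s := hMm.trans_le hs.1
  set I := ∫⁻ r in Ioc m r₁, ENNReal.ofReal (ψ r ^ 2)
  set G := ∫⁻ r in Ioc M r₁, ENNReal.ofReal ((r - M) ^ (2 - p) * deriv ψ r ^ 2)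
  have hpt : ENNReal.ofReal (ψ s ^ 2) ≤ ENNReal.ofReal (a / 2)⁻¹ * I := by
    have h : ∫⁻ _ in Ioc m r₁, ENNReal.ofReal (ψ s ^ 2) ≤ I :=
      setLIntegral_mono' measurableSet_Ioc fun x hx =>
        ENNReal.ofReal_le_ofReal (hmin (Ioc_subset_Icc_self hx))
    rw [setLIntegral_const, Real.volume_Ioc, show r₁ - m = a / 2 by simp only [m]; linarith] at h
    calc ENNReal.ofReal (ψ s ^ 2)
        = ENNReal.ofReal (a / 2)⁻¹ * (ENNReal.ofReal (ψ s ^ 2) * ENNReal.ofReal (a / 2)) := by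
          rw [← ENNReal.ofReal_mul (sq_nonneg _), ← ENNReal.ofReal_mul (by positivity)]
          congr 1
          field_simp
      _ ≤ _ := by gcongr
  have hnear : ENNReal.ofReal ((1 - p) ^ 2) *
      ∫⁻ r in Ioc M s, ENNReal.ofReal ((r - M) ^ (-p) * ψ r ^ 2) ≤
      ENNReal.ofReal (4 * K * (a / 2)⁻¹) * I + ENNReal.ofReal 4 * G := by
    have h := lintegral_rpow_hardy hMs.le (sub_pos.2 hp') (hψ.mono (Icc_subset_Icc_right hs.2))
      fun x hx => hψd x (Ioo_subset_Ioo_right hs.2 hx)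
    rw [show 1 - p - 1 = -p by ring, show 1 - p + 1 = 2 - p by ring] at h
    refine h.trans (add_le_add ?_ ?_)
    · calc ENNReal.ofReal (2 * (1 - p) * (s - M) ^ (1 - p) * ψ s ^ 2)
          ≤ ENNReal.ofReal (4 * K * ψ s ^ 2) := by
            apply ENNReal.ofReal_le_ofReal
            gcongr ?_ * _
            have hsK := hKb (s - M) (1 - p) (by simp only [m] at hs; linarith [hs.1])
              (by linarith [hs.2]) (by linarith) (by linarith)
            exact mul_le_mul (by linarith) hsK (rpow_nonneg (by linarith) _) (by norm_num)
        _ = ENNReal.ofReal (4 * K) * ENNReal.ofReal (ψ s ^ 2) :=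
            ENNReal.ofReal_mul (by positivity)
        _ ≤ ENNReal.ofReal (4 * K) * (ENNReal.ofReal (a / 2)⁻¹ * I) := by gcongr
        _ = _ := by rw [← mul_assoc, ← ENNReal.ofReal_mul (by positivity)]
    · gcongr
      exact lintegral_mono_set (Ioc_subset_Ioc_right hs.2)
  have hfar : ENNReal.ofReal ((1 - p) ^ 2) *
      ∫⁻ r in Ioc s r₁, ENNReal.ofReal ((r - M) ^ (-p) * ψ r ^ 2) ≤
      ENNReal.ofReal (4 * K) * I := by
    rw [ENNReal.ofReal_mul (by norm_num), mul_assoc]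
    refine mul_le_mul' (ENNReal.ofReal_le_ofReal (by nlinarith)) ?_
    rw [← lintegral_const_mul' _ _ ENNReal.ofReal_ne_top]
    refine (lintegral_mono_set (Ioc_subset_Ioc_left hs.1)).trans
      (setLIntegral_mono' measurableSet_Ioc fun x hx => ?_)
    rw [← ENNReal.ofReal_mul hK.le]
    apply ENNReal.ofReal_le_ofReal
    gcongr
    exact hKb (x - M) (-p) (by simp only [m] at hx; linarith [hx.1]) (by linarith [hx.2])
      (by linarith) (by linarith)
  have hI : I ≤ ENNReal.ofReal (4 * M ^ 2) * ∫⁻ r in Ioc m r₁, ENNReal.ofReal (φ r ^ 2) := by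
    rw [← lintegral_const_mul' _ _ ENNReal.ofReal_ne_top]
    refine setLIntegral_mono' measurableSet_Ioc fun x hx => ?_
    rw [← ENNReal.ofReal_mul (by positivity)]
    apply ENNReal.ofReal_le_ofReal
    simp only [ψ, mul_pow]
    gcongr
    nlinarith [hx.1, hx.2]
  have hG : G ≤ ENNReal.ofReal (4 * M ^ 2) * ∫⁻ r in Ioc M r₁,
      ENNReal.ofReal ((r - M) ^ (2 - p) * r ^ (-2 : ℝ) * deriv ψ r ^ 2) := by
    rw [← lintegral_const_mul' _ _ ENNReal.ofReal_ne_top]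
    refine setLIntegral_mono' measurableSet_Ioc fun x hx => ?_
    rw [← ENNReal.ofReal_mul (by positivity)]
    apply ENNReal.ofReal_le_ofReal
    have hx0 : 0 < x := hM.trans hx.1
    have hw : 0 ≤ (x - M) ^ (2 - p) := rpow_nonneg (by linarith [hx.1]) _
    have h1x : 1 ≤ 4 * M ^ 2 * x ^ (-2 : ℝ) := by
      rw [rpow_neg hx0.le, rpow_two, ← div_eq_mul_inv, one_le_div (by positivity)]
      nlinarith [hx.1, hx.2]
    calc (x - M) ^ (2 - p) * deriv ψ x ^ 2
        ≤ (4 * M ^ 2 * x ^ (-2 : ℝ)) * ((x - M) ^ (2 - p) * deriv ψ x ^ 2) :=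
          le_mul_of_one_le_left (by positivity) h1x
      _ = _ := by ring
  have hsplit : ∫⁻ r in Ioc M r₁, ENNReal.ofReal ((r - M) ^ (-p) * r ^ 2 * φ r ^ 2) =
      (∫⁻ r in Ioc M s, ENNReal.ofReal ((r - M) ^ (-p) * ψ r ^ 2)) +
        ∫⁻ r in Ioc s r₁, ENNReal.ofReal ((r - M) ^ (-p) * ψ r ^ 2) := by
    rw [← lintegral_union measurableSet_Ioc (Ioc_disjoint_Ioc_of_le le_rfl),
      Ioc_union_Ioc_eq_Ioc hMs.le hs.2]
    simp only [ψ, mul_pow, mul_assoc]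
  rw [hsplit, mul_add]
  set B := 4 + 4 * K * ((a / 2)⁻¹ + 1) with hB
  have hKa : 0 < K * (a / 2)⁻¹ := by positivity
  calc _ ≤ (ENNReal.ofReal (4 * K * (a / 2)⁻¹) * I + ENNReal.ofReal 4 * G) +
        ENNReal.ofReal (4 * K) * I := add_le_add hnear hfar
    _ = ENNReal.ofReal 4 * G + ENNReal.ofReal (4 * K * (a / 2)⁻¹ + 4 * K) * I := by
        rw [ENNReal.ofReal_add (by positivity) (by positivity)]
        ring
    _ ≤ ENNReal.ofReal B * G + ENNReal.ofReal B * I := by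
        gcongr <;> rw [hB] <;> nlinarith
    _ ≤ _ := by
        rw [← mul_add, mul_comm (4 * M ^ 2) B, ENNReal.ofReal_mul (by positivity), mul_assoc]
        gcongr
        rw [mul_add]
        exact add_le_add hG hI
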